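/- Let F : A → B be a full, faithful, and exact functor between abelian categories that lifts subobjects. Then the induced map ASpec F : ASpec A → ASpec B, ⟨H⟩ ↦ ⟨FH⟩, is injective, continuous, and open with respect to the localization topologies, and order-preserving with respect to the specialization orders. -/

import Mathlib

/-!
Basic notions from Kanda's theory of atoms in abelian categories.
-/

open CategoryTheory CategoryTheory.Limits

namespace AtomSpectrum

variable {C : Type*} [Category C] [Abelian C]

/-- An object `H` of an abelian category is *monoform* if `H ≠ 0` and for every non-zero
subobject `N ↣ H` there is no common non-zero subobject of `H` and `H/N`; that is, whenever
there are monomorphisms `H ↢ X ↣ H/N`, then `X = 0`. -/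
def Monoform (H : C) : Prop :=
  ¬ IsZero H ∧
    ∀ (N : Subobject H), ¬ IsZero (N : C) →
      ∀ (X : C) (f : X ⟶ H) (g : X ⟶ cokernel N.arrow), Mono f → Mono g → IsZero X

/-- Two objects are *atom equivalent* if they have a common non-zero subobject. -/
def AtomEquiv (H H' : C) : Prop :=
  ∃ (M : C) (f : M ⟶ H) (g : M ⟶ H'), Mono f ∧ Mono g ∧ ¬ IsZero M

variable (C) in
/-- The *atom spectrum* of an abelian category: atom-equivalence classes of monoform objects. -/
def ASpec : Type _ :=
  Quot (fun H H' : {H : C // Monoform H} => AtomEquiv H.1 H'.1)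

/-- The atom `⟨H⟩` determined by a monoform object `H`. -/
def atom (H : C) (h : Monoform H) : ASpec C := Quot.mk _ ⟨H, h⟩

/-- The *atom support* of an object `M`: all atoms `⟨H⟩` where `H` is a monoform subquotient
`L/L'` of `M` (for subobjects `L' ⊆ L ⊆ M`). -/
def ASupp (M : C) : Set (ASpec C) :=
  {α | ∃ (H : C) (h : Monoform H), atom H h = α ∧
    ∃ (L : Subobject M) (L' : Subobject (L : C)), Nonempty (H ≅ cokernel L'.arrow)}

/-- The localization topology on the atom spectrum: a set `Φ` is open iff for every
`⟨H⟩ ∈ Φ` there is some `H'` atom equivalent to `H` with `ASupp H' ⊆ Φ`. -/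
instance : TopologicalSpace (ASpec C) :=
  TopologicalSpace.generateFrom
    {Φ | ∀ (H : C) (h : Monoform H), atom H h ∈ Φ →
      ∃ (H' : C) (_ : Monoform H'), AtomEquiv H' H ∧ ASupp H' ⊆ Φ}

end AtomSpectrum

namespace CategoryTheory.Functor

open CategoryTheory

variable {A : Type*} {B : Type*} [Category A] [Category B]

/-- A functor `F : A ⥤ B` *lifts subobjects* if every monomorphism `ι : Y ↣ F.obj X` is,
up to isomorphism, of the form `F.map ι'` for a monomorphism `ι' : X' ↣ X`. -/
def LiftsSubobjects (F : A ⥤ B) : Prop :=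
  ∀ (X : A) (Y : B) (ι : Y ⟶ F.obj X), Mono ι →
    ∃ (X' : A) (ι' : X' ⟶ X), Mono ι' ∧ ∃ e : Y ≅ F.obj X', e.hom ≫ F.map ι' = ι

/-- An additive functor between abelian categories is *exact* if it preserves finite limits
and finite colimits. -/
def IsExact (F : A ⥤ B) : Prop :=
  Nonempty (Limits.PreservesFiniteLimits F) ∧ Nonempty (Limits.PreservesFiniteColimits F)

end CategoryTheory.Functor

namespace AtomSpectrum

open CategoryTheory CategoryTheory.Limits

lemma AtomEquiv.symm {C : Type*} [Category C] {H H' : C} : AtomEquiv H H' → AtomEquiv H' H :=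
  fun ⟨M, f, g, hf, hg, hM⟩ ↦ ⟨M, g, f, hg, hf, hM⟩

section Abelian

variable {C : Type*} [Category C] [Abelian C]

/-- An epimorphism is a cokernel of any morphism isomorphic to the inclusion of its kernel. -/
noncomputable def isCokernelOfIsoKernel {H Q K : C} (p : H ⟶ Q) [Epi p] (j : K ⟶ H)
    (e : K ≅ kernel p) (he : e.hom ≫ kernel.ι p = j) (w : j ≫ p = 0) :
    IsColimit (CokernelCofork.ofπ p w) :=
  isCokernelEpiComp (Abelian.epiIsCokernelOfKernel _ (kernelIsKernel p)) e.hom he.symm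

lemma nonempty_iso_cokernel {H Q : C} (p : H ⟶ Q) [Epi p] :
    Nonempty (Q ≅ cokernel (Subobject.mk (kernel.ι p)).arrow) :=
  ⟨(isCokernelOfIsoKernel p (Subobject.mk (kernel.ι p)).arrow
    (Subobject.underlyingIso (kernel.ι p)) (by simp)
    (by rw [← Subobject.underlyingIso_hom_comp_eq_mk]; simp)).coconePointUniqueUpToIso
      (colimit.isColimit _)⟩

/-- Monoformness in terms of quotient morphisms: a quotient sharing a non-zero subobject with `H`
is not proper. -/
lemma monoform_iff {H : C} :
    Monoform H ↔ ¬ IsZero H ∧ ∀ (Q : C) (p : H ⟶ Q), Epi p →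
      ∀ (X : C) (f : X ⟶ H) (g : X ⟶ Q), Mono f → Mono g → ¬ IsZero X → Mono p := by
  refine and_congr_right fun _ ↦ ⟨fun h Q p _ X f g _ _ hX ↦ ?_, fun h N hN X f g _ _ ↦ ?_⟩
  · by_contra hp
    obtain ⟨e⟩ := nonempty_iso_cokernel p
    refine hX (h (Subobject.mk (kernel.ι p)) (fun hz ↦ hp ?_) X f (g ≫ e.hom)
      inferInstance inferInstance)
    exact Preadditive.mono_of_isZero_kernel p
      (hz.of_iso (Subobject.underlyingIso (kernel.ι p)).symm)
  · by_contra hX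
    have := h _ (cokernel.π N.arrow) inferInstance X f g ‹_› ‹_› hX
    have h0 : N.arrow = 0 := zero_of_comp_mono _ (cokernel.condition N.arrow)
    exact hN (IsZero.of_mono_eq_zero _ h0)

lemma mem_ASupp_iff {M : C} {α : ASpec C} :
    α ∈ ASupp M ↔ ∃ (H : C) (h : Monoform H), atom H h = α ∧
      ∃ (L : C) (i : L ⟶ M) (p : L ⟶ H), Mono i ∧ Epi p := by
  constructor
  · rintro ⟨H, h, rfl, L, L', ⟨e⟩⟩
    exact ⟨H, h, rfl, L, L.arrow, cokernel.π L'.arrow ≫ e.inv, inferInstance, inferInstance⟩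
  · rintro ⟨H, h, rfl, L, i, p, _, _⟩
    exact ⟨H, h, rfl, Subobject.mk i, _,
      nonempty_iso_cokernel ((Subobject.underlyingIso i).hom ≫ p)⟩

lemma ASupp_subset_of_mono {M N : C} (i : M ⟶ N) [Mono i] : ASupp M ⊆ ASupp N := by
  intro α hα
  obtain ⟨H, h, rfl, L, j, p, _, hp⟩ := mem_ASupp_iff.1 hα
  exact mem_ASupp_iff.2 ⟨H, h, rfl, L, j ≫ i, p, inferInstance, hp⟩

lemma Monoform.of_mono {M H : C} (h : Monoform H) (i : M ⟶ H) [Mono i] (hM : ¬ IsZero M) :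
    Monoform M := by
  refine monoform_iff.2 ⟨hM, fun Q p _ X f g _ _ hX ↦ ?_⟩
  have : Mono (pushout.inl i p) :=
    (monoform_iff.1 h).2 _ (pushout.inl i p) inferInstance X (f ≫ i) (g ≫ pushout.inr i p)
      inferInstance inferInstance hX
  have : Mono (p ≫ pushout.inr i p) := by rw [← pushout.condition]; infer_instance
  exact mono_of_mono p (pushout.inr i p)

/-- Monoform objects are uniform. -/
lemma Monoform.not_isZero_pullback {H M M' : C} (h : Monoform H) (i : M ⟶ H) (j : M' ⟶ H)
    [Mono i] [Mono j] (hM : ¬ IsZero M) (hM' : ¬ IsZero M') : ¬ IsZero (pullback i j) := by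
  intro hz
  have hmono : Mono (i ≫ cokernel.π j) := by
    refine Preadditive.mono_of_cancel_zero _ fun g hg ↦ ?_
    have hg' : (g ≫ i) ≫ cokernel.π j = 0 := by simpa using hg
    have : g = pullback.lift g (Abelian.monoLift j (g ≫ i) hg') (by simp) ≫ pullback.fst i j :=
      (pullback.lift_fst _ _ _).symm
    rw [this, hz.eq_of_src (pullback.fst i j) 0, comp_zero]
  have : Mono (cokernel.π j) :=
    (monoform_iff.1 h).2 _ _ inferInstance M i (i ≫ cokernel.π j) inferInstance hmono hM
  exact hM' (IsZero.of_mono_eq_zero j (zero_of_comp_mono _ (cokernel.condition j)))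

lemma AtomEquiv.trans {H H' H'' : C} (h' : Monoform H') (h₁ : AtomEquiv H H')
    (h₂ : AtomEquiv H' H'') : AtomEquiv H H'' := by
  obtain ⟨M, f, g, _, _, hM⟩ := h₁
  obtain ⟨N, k, l, _, _, hN⟩ := h₂
  exact ⟨pullback g k, pullback.fst g k ≫ f, pullback.snd g k ≫ l, inferInstance, inferInstance,
    h'.not_isZero_pullback g k hM hN⟩

lemma atom_eq_atom_iff {H H' : C} {h : Monoform H} {h' : Monoform H'} :
    atom H h = atom H' h' ↔ AtomEquiv H H' := by
  refine ⟨fun e ↦ ?_, fun e ↦ Quot.sound e⟩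
  have equiv : Equivalence (fun H H' : {H : C // Monoform H} ↦ AtomEquiv H.1 H'.1) :=
    ⟨fun H ↦ ⟨H.1, 𝟙 _, 𝟙 _, inferInstance, inferInstance, H.2.1⟩, AtomEquiv.symm,
      fun {_ H _} ↦ AtomEquiv.trans H.2⟩
  exact equiv.eqvGen_iff.1 (Quot.eqvGen_exact e)

end Abelian

section Functor

variable {A B : Type*} [Category A] [Category B] [Abelian A] [Abelian B] {F : A ⥤ B}

lemma exists_map_epi [PreservesFiniteColimits F]
    (hlift : F.LiftsSubobjects) {X : A} {Q : B} (p : F.obj X ⟶ Q) [Epi p] :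
    ∃ (Q' : A) (p' : X ⟶ Q') (e : F.obj Q' ≅ Q), Epi p' ∧ F.map p' ≫ e.hom = p := by
  obtain ⟨K, i, _, e, he⟩ := hlift X _ (kernel.ι p) inferInstance
  have hi : e.inv ≫ kernel.ι p = F.map i := by rw [← he, e.inv_hom_id_assoc]
  have w : F.map i ≫ p = 0 := by rw [← hi]; simp
  let hp := isCokernelOfIsoKernel p (F.map i) e.symm hi w
  let hF := isColimitOfHasCokernelOfPreservesColimit F i
  refine ⟨cokernel i, cokernel.π i, hF.coconePointUniqueUpToIso hp, inferInstance, ?_⟩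
  exact hF.comp_coconePointUniqueUpToIso_hom hp WalkingParallelPair.one

variable [F.Full] [F.Faithful]

lemma monoform_obj_iff [PreservesFiniteLimits F] [PreservesFiniteColimits F]
    (hlift : F.LiftsSubobjects) {H : A} :
    Monoform (F.obj H) ↔ Monoform H := by
  rw [monoform_iff, monoform_iff]
  refine and_congr (not_congr ⟨IsZero.of_full_of_faithful_of_isZero F H, F.map_isZero⟩)
    ⟨fun h Q p _ X f g _ _ hX ↦ ?_, fun h Q p _ X f g _ _ hX ↦ ?_⟩
  · exact F.mono_of_mono_map (h _ (F.map p) inferInstance _ (F.map f) (F.map g) inferInstance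
      inferInstance fun hz ↦ hX (IsZero.of_full_of_faithful_of_isZero F X hz))
  · obtain ⟨Q', p', e, _, rfl⟩ := exists_map_epi hlift p
    obtain ⟨X', f', _, eX, rfl⟩ := hlift _ _ f inferInstance
    have : Mono (F.preimage (eX.inv ≫ g ≫ e.inv)) :=
      F.mono_of_mono_map (by rw [F.map_preimage]; infer_instance)
    have : Mono p' := h _ p' inferInstance X' f' (F.preimage (eX.inv ≫ g ≫ e.inv)) inferInstance
      inferInstance fun hz ↦ hX ((F.map_isZero hz).of_iso eX)
    infer_instance

lemma atomEquiv_obj_iff [PreservesFiniteLimits F]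
    (hlift : F.LiftsSubobjects) {H H' : A} :
    AtomEquiv (F.obj H) (F.obj H') ↔ AtomEquiv H H' := by
  constructor
  · rintro ⟨M, f, g, _, _, hM⟩
    obtain ⟨M', f', _, e, rfl⟩ := hlift _ _ f inferInstance
    refine ⟨M', f', F.preimage (e.inv ≫ g), inferInstance,
      F.mono_of_mono_map (by rw [F.map_preimage]; infer_instance),
      fun hz ↦ hM ((F.map_isZero hz).of_iso e)⟩
  · rintro ⟨M, f, g, _, _, hM⟩
    exact ⟨F.obj M, F.map f, F.map g, inferInstance, inferInstance,
      fun hz ↦ hM (IsZero.of_full_of_faithful_of_isZero F M hz)⟩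

/-- The map on atom spectra induced by a fully faithful exact functor lifting subobjects. -/
def aspecMap [PreservesFiniteLimits F] [PreservesFiniteColimits F]
    (hlift : F.LiftsSubobjects) : ASpec A → ASpec B :=
  Quot.map (fun H ↦ ⟨F.obj H.1, (monoform_obj_iff hlift).2 H.2⟩)
    fun _ _ ↦ (atomEquiv_obj_iff hlift).2

variable [PreservesFiniteLimits F] [PreservesFiniteColimits F] (hlift : F.LiftsSubobjects)

lemma aspecMap_atom {H : A} (h : Monoform H) :
    aspecMap hlift (atom H h) = atom (F.obj H) ((monoform_obj_iff hlift).2 h) := rfl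

lemma aspecMap_injective : Function.Injective (aspecMap hlift) := by
  rintro ⟨H, h⟩ ⟨H', h'⟩ e
  exact atom_eq_atom_iff.2 ((atomEquiv_obj_iff hlift).1 (atom_eq_atom_iff.1 e))

lemma ASupp_obj (M : A) : ASupp (F.obj M) = aspecMap hlift '' ASupp M := by
  apply Set.Subset.antisymm
  · intro α hα
    obtain ⟨H, h, rfl, L, i, p, _, _⟩ := mem_ASupp_iff.1 hα
    obtain ⟨L', i', _, e, rfl⟩ := hlift _ _ i inferInstance
    obtain ⟨H', p', e', _, -⟩ := exists_map_epi hlift (e.inv ≫ p)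
    have hequiv : AtomEquiv (F.obj H') H :=
      ⟨H, e'.inv, 𝟙 H, inferInstance, inferInstance, h.1⟩
    have hF : Monoform (F.obj H') :=
      h.of_mono e'.hom fun hz ↦ h.1 (hz.of_iso e'.symm)
    have h' := (monoform_obj_iff hlift).1 hF
    exact ⟨atom H' h', mem_ASupp_iff.2 ⟨H', h', rfl, L', i', p', inferInstance, inferInstance⟩,
      atom_eq_atom_iff.2 hequiv⟩
  · rintro _ ⟨α, hα, rfl⟩
    obtain ⟨H, h, rfl, L, i, p, _, _⟩ := mem_ASupp_iff.1 hα
    exact mem_ASupp_iff.2 ⟨F.obj H, (monoform_obj_iff hlift).2 h, rfl, F.obj L, F.map i, F.map p,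
      inferInstance, inferInstance⟩

lemma continuous_aspecMap : Continuous (aspecMap hlift) := by
  refine continuous_generateFrom_iff.2 fun Φ hΦ ↦ .basic _ fun H h hmem ↦ ?_
  obtain ⟨H', h', ⟨M, f, g, _, _, hM⟩, hsub⟩ := hΦ _ _ hmem
  obtain ⟨X, i, _, e, -⟩ := hlift _ _ g inferInstance
  have hX : ¬ IsZero X := fun hz ↦ hM ((F.map_isZero hz).of_iso e)
  refine ⟨X, h.of_mono i hX, ⟨X, 𝟙 X, i, inferInstance, inferInstance, hX⟩, ?_⟩
  rw [← Set.image_subset_iff, ← ASupp_obj hlift]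
  exact (ASupp_subset_of_mono (e.inv ≫ f)).trans hsub

lemma isOpenMap_aspecMap : IsOpenMap (aspecMap hlift) := by
  have key : ∀ Φ : Set (ASpec A), (∀ (H : A) (h : Monoform H), atom H h ∈ Φ →
      ∃ (H' : A) (_ : Monoform H'), AtomEquiv H' H ∧ ASupp H' ⊆ Φ) →
      IsOpen (aspecMap hlift '' Φ) := by
    refine fun Φ hΦ ↦ .basic _ ?_
    rintro K hK ⟨⟨H, h⟩, hmem, heq⟩
    obtain ⟨H', h', hequiv, hsub⟩ := hΦ H h hmem
    refine ⟨F.obj H', (monoform_obj_iff hlift).2 h',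
      ((atomEquiv_obj_iff hlift).2 hequiv).trans ((monoform_obj_iff hlift).2 h)
        (atom_eq_atom_iff.1 heq), ?_⟩
    rw [ASupp_obj hlift]
    exact Set.image_mono hsub
  intro U hU
  induction hU with
  | basic Φ hΦ => exact key Φ hΦ
  | univ => exact key _ fun H h _ ↦
      ⟨H, h, ⟨H, 𝟙 H, 𝟙 H, inferInstance, inferInstance, h.1⟩, Set.subset_univ _⟩
  | inter s t _ _ hs ht =>
    rw [Set.image_inter (aspecMap_injective hlift)]
    exact hs.inter ht
  | sUnion S _ ih =>
    rw [Set.sUnion_eq_biUnion, Set.image_iUnion₂]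
    exact isOpen_biUnion ih

end Functor

end AtomSpectrum

open CategoryTheory CategoryTheory.Limits AtomSpectrum

/-- Let `F : A ⥤ B` be a full, faithful and exact functor between abelian
categories that lifts subobjects.  Then the induced map `ASpec F : ASpec A → ASpec B`,
`⟨H⟩ ↦ ⟨F.obj H⟩`, is injective, continuous and open for the localization topologies, and
order-preserving for the specialization orders. -/
theorem aspecMap_injective_continuous_open_orderPreserving
    {A B : Type*} [Category A] [Category B] [Abelian A] [Abelian B]
    (F : A ⥤ B) [F.Full] [F.Faithful] (hex : F.IsExact) (hlift : F.LiftsSubobjects) :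
    ∃ f : ASpec A → ASpec B,
      (∀ (H : A) (h : Monoform H), ∃ h' : Monoform (F.obj H), f (atom H h) = atom (F.obj H) h') ∧
      Function.Injective f ∧ Continuous f ∧ IsOpenMap f ∧
      (∀ α β : ASpec A, α ∈ closure {β} → f α ∈ closure {f β}) := by
  have := hex.1.some
  have := hex.2.some
  refine ⟨aspecMap hlift, fun H h ↦ ⟨_, aspecMap_atom hlift h⟩, aspecMap_injective hlift,
    continuous_aspecMap hlift, isOpenMap_aspecMap hlift, fun α β h ↦ ?_⟩
  simpa using image_closure_subset_closure_image (continuous_aspecMap hlift) ⟨α, h, rfl⟩
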